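/- There is no exactly 2-to-1 function from [0,1] onto a compact metric space that has only finitely many discontinuities. -/

import Mathlib

open Set Filter Topology

/-- `Ioo a b` is a bounded connected component of the complement of `E`. -/
structure IsGap (E : Set ℝ) (a b : ℝ) : Prop where
  lt : a < b
  left_mem : a ∈ E
  right_mem : b ∈ E
  notMem : ∀ x ∈ Ioo a b, x ∉ E

namespace IsGap

variable {E : Set ℝ} {a b c d x : ℝ}

theorem eq_of_mem (h : IsGap E a b) (h' : IsGap E c d) (hx : x ∈ Ioo a b) (hx' : x ∈ Ioo c d) :
    a = c ∧ b = d := by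
  have h1 := h.notMem c
  have h2 := h.notMem d
  have h3 := h'.notMem a
  have h4 := h'.notMem b
  have := h.left_mem
  have := h.right_mem
  have := h'.left_mem
  have := h'.right_mem
  simp only [mem_Ioo] at *
  constructor
  · rcases lt_trichotomy a c with h0 | h0 | h0
    · exact absurd h'.left_mem (h1 ⟨h0, by linarith⟩)
    · exact h0
    · exact absurd h.left_mem (h3 ⟨h0, by linarith⟩)
  · rcases lt_trichotomy b d with h0 | h0 | h0
    · exact absurd h.right_mem (h4 ⟨by linarith, h0⟩)
    · exact h0
    · exact absurd h'.right_mem (h2 ⟨by linarith, h0⟩)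

theorem right_unique (h : IsGap E a b) (h' : IsGap E a c) : b = c := by
  have hl := h.lt
  have hl' := h'.lt
  obtain ⟨x, hx, hx'⟩ := exists_between (lt_min hl hl')
  exact (h.eq_of_mem h' ⟨hx, hx'.trans_le (min_le_left _ _)⟩
    ⟨hx, hx'.trans_le (min_le_right _ _)⟩).2

theorem left_unique (h : IsGap E a c) (h' : IsGap E b c) : a = b := by
  have hl := h.lt
  have hl' := h'.lt
  obtain ⟨x, hx, hx'⟩ := exists_between (max_lt hl hl')
  exact (h.eq_of_mem h' ⟨(le_max_left _ _).trans_lt hx, hx'⟩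
    ⟨(le_max_right _ _).trans_lt hx, hx'⟩).1

theorem midpoint_mem (h : IsGap E a b) : (a + b) / 2 ∈ Ioo a b := by
  have := h.lt
  constructor <;> linarith

/-- A point of `E` lying right of some point of a gap lies right of the gap. -/
theorem le_of_mem (h : IsGap E a b) (hx : x ∈ Ioo a b) (hc : c ∈ E) (hxc : x ≤ c) : b ≤ c := by
  by_contra! h0
  exact h.notMem c ⟨hx.1.trans_le hxc, h0⟩ hc

theorem ge_of_mem (h : IsGap E a b) (hx : x ∈ Ioo a b) (hc : c ∈ E) (hxc : c ≤ x) : c ≤ a := by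
  by_contra! h0
  exact h.notMem c ⟨h0, hxc.trans_lt hx.2⟩ hc

end IsGap

theorem exists_isGap {E : Set ℝ} (hE : IsClosed E) {x u v : ℝ} (hx : x ∉ E) (hu : u ∈ E)
    (hux : u ≤ x) (hv : v ∈ E) (hxv : x ≤ v) : ∃ a b, IsGap E a b ∧ x ∈ Ioo a b := by
  have h1 := (hE.inter isClosed_Iic).isGreatest_csSup (s := E ∩ Iic x) ⟨u, hu, hux⟩
    ⟨x, fun y hy => hy.2⟩
  have h2 := (hE.inter isClosed_Ici).isLeast_csInf (s := E ∩ Ici x) ⟨v, hv, hxv⟩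
    ⟨x, fun y hy => hy.2⟩
  set a := sSup (E ∩ Iic x)
  set b := sInf (E ∩ Ici x)
  have ha : a < x := lt_of_le_of_ne h1.1.2 (fun h => hx (h ▸ h1.1.1))
  have hb : x < b := lt_of_le_of_ne h2.1.2 (fun h => hx (h ▸ h2.1.1))
  refine ⟨a, b, ⟨ha.trans hb, h1.1.1, h2.1.1, fun y hy hyE => ?_⟩, ha, hb⟩
  rcases le_total y x with h | h
  · exact absurd (h1.2 ⟨hyE, h⟩) (not_le.2 hy.1)
  · exact absurd (h2.2 ⟨hyE, h⟩) (not_le.2 hy.2)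

/-- One-dimensional invariance of domain. -/
theorem image_mem_nhds_of_injOn {g : ℝ → ℝ} {O W : Set ℝ} {x : ℝ} (hO : O ∈ 𝓝 x)
    (hg : ContinuousOn g O) (hi : InjOn g O) (hW : W ∈ 𝓝 x) : g '' W ∈ 𝓝 (g x) := by
  obtain ⟨ε, hε, hsub⟩ := Metric.nhds_basis_closedBall.mem_iff.1 (inter_mem hO hW)
  rw [Real.closedBall_eq_Icc] at hsub
  have hc := hg.mono (hsub.trans inter_subset_left)
  have hin := hi.mono (hsub.trans inter_subset_left)
  have hle : x - ε ≤ x + ε := by linarith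
  have hl : x - ε ∈ Icc (x - ε) (x + ε) := ⟨le_rfl, hle⟩
  have hr : x + ε ∈ Icc (x - ε) (x + ε) := ⟨hle, le_rfl⟩
  have hm : x ∈ Icc (x - ε) (x + ε) := ⟨by linarith, by linarith⟩
  have himg : g '' Icc (x - ε) (x + ε) ⊆ g '' W := image_mono (hsub.trans inter_subset_right)
  rcases hc.strictMonoOn_of_injOn_Icc' hle hin with h | h
  · refine mem_of_superset (Icc_mem_nhds (h hl hm (by linarith)) (h hm hr (by linarith)))
      ((intermediate_value_Icc hle hc).trans himg)
  · refine mem_of_superset (Icc_mem_nhds (h hm hr (by linarith)) (h hl hm (by linarith)))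
      ((intermediate_value_Icc' hle hc).trans himg)

theorem even_card_of_involution {α : Type*} (t : Finset α) (g : ∀ x ∈ t, α)
    (hne : ∀ x hx, g x hx ≠ x) (hmem : ∀ x hx, g x hx ∈ t)
    (hinv : ∀ x hx, g (g x hx) (hmem x hx) = x) : Even t.card := by
  have h1 : ∑ _x ∈ t, (1 : ZMod 2) = 0 :=
    Finset.sum_involution g (fun _ _ => by decide) (fun x hx _ => hne x hx) hmem hinv
  simp only [Finset.sum_const, nsmul_eq_mul, mul_one] at h1
  exact (ZMod.natCast_eq_zero_iff_even).1 h1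

theorem dist_lt_of_mem_Ioo {u v x y ε : ℝ} (huv : v - u < ε) (hx : x ∈ Ioo u v)
    (hy : y ∈ Ioo u v) : |x - y| < ε := by
  rw [abs_lt]
  constructor <;> linarith [hx.1, hx.2, hy.1, hy.2]

/-- A fixed-point-free involution `s` of the line preserving the unit interval, the model being the
involution exchanging the two points in each fibre of a 2-to-1 function on the interval; `D` is
the set near which nothing is known. -/
structure IsPairing (s : ℝ → ℝ) (D : Set ℝ) : Prop where
  invol : ∀ x, s (s x) = x
  ne_self : ∀ x, s x ≠ x
  mem_Icc : ∀ x ∈ Icc (0 : ℝ) 1, s x ∈ Icc (0 : ℝ) 1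
  finite : D.Finite
  subset : D ⊆ Icc 0 1
  zero_mem : (0 : ℝ) ∈ D
  one_mem : (1 : ℝ) ∈ D
  mem_of_mem : ∀ x ∈ D, s x ∈ D
  eq_or_eq : ∀ (F : Filter ℝ) [F.NeBot] (x w : ℝ), x ∈ Icc (0 : ℝ) 1 \ D → w ∈ Icc (0 : ℝ) 1 \ D →
    F ≤ 𝓝 x → Tendsto s F (𝓝 w) → w = x ∨ w = s x

/-- The points near which `s` is continuous. -/
def regularSet (s : ℝ → ℝ) (D : Set ℝ) : Set ℝ :=
  interior {x | x ∈ Icc (0 : ℝ) 1 \ D ∧ ContinuousAt s x}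

/-- The points near which `s` is not continuous, together with everything off the domain. -/
def singularSet (s : ℝ → ℝ) (D : Set ℝ) : Set ℝ := (regularSet s D)ᶜ

namespace IsPairing

variable {s : ℝ → ℝ} {D : Set ℝ} {a b c d x : ℝ}

theorem injective (h : IsPairing s D) : Function.Injective s :=
  Function.Involutive.injective h.invol

theorem mem_diff (h : IsPairing s D) (hx : x ∈ Icc (0 : ℝ) 1 \ D) : s x ∈ Icc (0 : ℝ) 1 \ D :=
  ⟨h.mem_Icc x hx.1, fun h' => hx.2 (h.invol x ▸ h.mem_of_mem _ h')⟩

theorem isOpen_diff (h : IsPairing s D) : IsOpen (Icc (0 : ℝ) 1 \ D) := by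
  have : Icc (0 : ℝ) 1 \ D = Ioo 0 1 \ D := by
    ext x
    constructor
    · rintro ⟨⟨h0, h1⟩, hx⟩
      refine ⟨⟨lt_of_le_of_ne h0 ?_, lt_of_le_of_ne h1 ?_⟩, hx⟩
      · rintro rfl; exact hx h.zero_mem
      · rintro rfl; exact hx h.one_mem
    · rintro ⟨h0, hx⟩
      exact ⟨Ioo_subset_Icc_self h0, hx⟩
  rw [this]
  exact isOpen_Ioo.sdiff h.finite.isClosed

theorem isOpen_regularSet (_h : IsPairing s D) : IsOpen (regularSet s D) := isOpen_interior

theorem isClosed_singularSet (_h : IsPairing s D) : IsClosed (singularSet s D) :=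
  isOpen_interior.isClosed_compl

theorem regularSet_subset (_h : IsPairing s D) : regularSet s D ⊆ Icc (0 : ℝ) 1 \ D :=
  fun _ hx => (interior_subset hx).1

theorem continuousOn_regularSet (_h : IsPairing s D) : ContinuousOn s (regularSet s D) :=
  fun _ hx => (interior_subset hx).2.continuousWithinAt

theorem subset_singularSet (h : IsPairing s D) : D ⊆ singularSet s D :=
  fun _ hx hx' => (h.regularSet_subset hx').2 hx

theorem mem_regularSet_of_mem (h : IsPairing s D) (hx : x ∈ regularSet s D) :
    s x ∈ regularSet s D := by
  have key : ∀ y ∈ regularSet s D, ∀ W ∈ 𝓝 y, s '' W ∈ 𝓝 (s y) := fun y hy W hW =>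
    image_mem_nhds_of_injOn (h.isOpen_regularSet.mem_nhds hy) h.continuousOn_regularSet
      h.injective.injOn hW
  refine mem_interior_iff_mem_nhds.2
    (mem_of_superset (key x hx _ (h.isOpen_regularSet.mem_nhds hx)) ?_)
  rintro _ ⟨y, hy, rfl⟩
  refine ⟨h.mem_diff (h.regularSet_subset hy), ?_⟩
  intro W hW
  rw [h.invol] at hW
  refine mem_map.2 (mem_of_superset (key y hy W hW) ?_)
  rintro _ ⟨z, hz, rfl⟩
  simpa [h.invol] using hz

theorem mem_singularSet_of_mem (h : IsPairing s D) (hx : x ∈ singularSet s D) :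
    s x ∈ singularSet s D := fun h' => hx (h.invol x ▸ h.mem_regularSet_of_mem h')

theorem notMem_singularSet (h : IsPairing s D) (hx : x ∉ singularSet s D) :
    s x ∉ singularSet s D := fun h' => hx (h.invol x ▸ h.mem_singularSet_of_mem h')

theorem exists_gap (h : IsPairing s D) (hx : x ∉ singularSet s D) :
    ∃ a b, IsGap (singularSet s D) a b ∧ x ∈ Ioo a b := by
  have hx' := h.regularSet_subset (notMem_compl_iff.1 hx)
  exact exists_isGap h.isClosed_singularSet hx (h.subset_singularSet h.zero_mem) hx'.1.1
    (h.subset_singularSet h.one_mem) hx'.1.2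

theorem gap_subset (_h : IsPairing s D) (hab : IsGap (singularSet s D) a b) :
    Ioo a b ⊆ regularSet s D := fun x hx => notMem_compl_iff.1 (hab.notMem x hx)

theorem gap_mem_Icc (h : IsPairing s D) (hab : IsGap (singularSet s D) a b) :
    a ∈ Icc (0 : ℝ) 1 ∧ b ∈ Icc (0 : ℝ) 1 := by
  have h1 : closure (Ioo a b) ⊆ Icc 0 1 :=
    closure_minimal (((h.gap_subset hab).trans h.regularSet_subset).trans sdiff_subset) isClosed_Icc
  rw [closure_Ioo hab.lt.ne] at h1
  exact ⟨h1 ⟨le_rfl, hab.lt.le⟩, h1 ⟨hab.lt.le, le_rfl⟩⟩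

/-- `s` maps gaps into gaps. -/
theorem image_subset (h : IsPairing s D) (hab : IsGap (singularSet s D) a b)
    (hcd : IsGap (singularSet s D) c d) (hx : x ∈ Ioo a b) (hsx : s x ∈ Ioo c d) :
    s '' Ioo a b ⊆ Ioo c d := by
  have hp : IsPreconnected (s '' Ioo a b) :=
    isPreconnected_Ioo.image s (h.continuousOn_regularSet.mono (h.gap_subset hab))
  have hn : ∀ y ∈ s '' Ioo a b, y ∉ singularSet s D := by
    rintro _ ⟨y, hy, rfl⟩
    exact h.notMem_singularSet (hab.notMem y hy)
  have hm : s x ∈ s '' Ioo a b := mem_image_of_mem s hx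
  intro y hy
  refine ⟨?_, ?_⟩ <;> by_contra! h0
  · exact hn c (hp.ordConnected.out hy hm ⟨h0, hsx.1.le⟩) hcd.left_mem
  · exact hn d (hp.ordConnected.out hm hy ⟨hsx.2.le, h0⟩) hcd.right_mem

theorem image_eq (h : IsPairing s D) (hab : IsGap (singularSet s D) a b)
    (hcd : IsGap (singularSet s D) c d) (hx : x ∈ Ioo a b) (hsx : s x ∈ Ioo c d) :
    s '' Ioo a b = Ioo c d := by
  refine (h.image_subset hab hcd hx hsx).antisymm fun y hy => ?_
  refine ⟨s y, ?_, h.invol y⟩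
  exact h.image_subset hcd hab hsx ((h.invol x).symm ▸ hx) (mem_image_of_mem s hy)

theorem exists_image_eq (h : IsPairing s D) (hab : IsGap (singularSet s D) a b) :
    ∃ c d, IsGap (singularSet s D) c d ∧ s '' Ioo a b = Ioo c d := by
  obtain ⟨c, d, hcd, hx⟩ := h.exists_gap (h.notMem_singularSet (hab.notMem _ hab.midpoint_mem))
  exact ⟨c, d, hcd, h.image_eq hab hcd hab.midpoint_mem hx⟩

theorem image_symm (h : IsPairing s D) {S T : Set ℝ} (hST : s '' S = T) : s '' T = S := by
  rw [← hST, image_image]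
  simp [h.invol]

theorem image_ne (h : IsPairing s D) (hab : IsGap (singularSet s D) a b) :
    s '' Ioo a b ≠ Ioo a b := by
  intro himg
  have hc : ContinuousOn s (Ioo a b) := h.continuousOn_regularSet.mono (h.gap_subset hab)
  have hm := hab.midpoint_mem
  have hsm : s ((a + b) / 2) ∈ Ioo a b := himg ▸ mem_image_of_mem s hm
  obtain ⟨y, -, hy⟩ : ∃ y ∈ Ioo a b, s y = y := by
    rcases le_total (s ((a + b) / 2)) ((a + b) / 2) with h0 | h0
    · exact isPreconnected_Ioo.intermediate_value₂ hm hsm hc continuousOn_id h0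
        (by simpa [h.invol] using h0)
    · exact isPreconnected_Ioo.intermediate_value₂ hsm hm hc continuousOn_id
        (by simpa [h.invol] using h0) h0
  exact h.ne_self y hy

/-- The behaviour of `s` at the two ends of a gap. -/
theorem tendsto_ends (h : IsPairing s D) (hab : IsGap (singularSet s D) a b)
    (himg : s '' Ioo a b = Ioo c d) (hcd : c < d) :
    (Tendsto s (𝓝[>] a) (𝓝 c) ∧ Tendsto s (𝓝[<] b) (𝓝 d)) ∨
    (Tendsto s (𝓝[>] a) (𝓝 d) ∧ Tendsto s (𝓝[<] b) (𝓝 c)) := by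
  have hc : ContinuousOn s (Ioo a b) := h.continuousOn_regularSet.mono (h.gap_subset hab)
  have hne : (Ioo a b).Nonempty := nonempty_Ioo.2 hab.lt
  have hba : BddAbove (s '' Ioo a b) := himg ▸ bddAbove_Ioo
  have hbb : BddBelow (s '' Ioo a b) := himg ▸ bddBelow_Ioo
  rcases hc.strictMonoOn_of_injOn_Ioo hab.lt h.injective.injOn with hm | hm
  · left
    have h1 := hm.monotoneOn.tendsto_nhdsWithin_Ioo_right hne hbb
    have h2 := hm.monotoneOn.tendsto_nhdsWithin_Ioo_left hne hba
    rw [himg] at h1 h2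
    rw [csInf_Ioo hcd] at h1
    rw [csSup_Ioo hcd] at h2
    exact ⟨h1, h2⟩
  · right
    have h1 := hm.antitoneOn.tendsto_nhdsWithin_Ioo_right hne hba
    have h2 := hm.antitoneOn.tendsto_nhdsWithin_Ioo_left hne hbb
    rw [himg] at h1 h2
    rw [csSup_Ioo hcd] at h1
    rw [csInf_Ioo hcd] at h2
    exact ⟨h1, h2⟩

end IsPairing

/-- A gap is bad if it or its image under `s` has an endpoint in `D`. -/
def IsBadGap (s : ℝ → ℝ) (D : Set ℝ) (a b : ℝ) : Prop :=
  IsGap (singularSet s D) a b ∧ ((a ∈ D ∨ b ∈ D) ∨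
    ∃ c d, IsGap (singularSet s D) c d ∧ s '' Ioo a b = Ioo c d ∧ (c ∈ D ∨ d ∈ D))

/-- The points of `D` and the endpoints of bad gaps. -/
def exceptionalSet (s : ℝ → ℝ) (D : Set ℝ) : Set ℝ :=
  D ∪ {x | ∃ a b, IsBadGap s D a b ∧ (x = a ∨ x = b)}

namespace IsPairing

variable {s : ℝ → ℝ} {D : Set ℝ} {a b c d x m e : ℝ}

theorem finite_exceptionalSet (h : IsPairing s D) : (exceptionalSet s D).Finite := by
  have hl : {p : ℝ × ℝ | IsGap (singularSet s D) p.1 p.2 ∧ p.1 ∈ D}.Finite := by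
    refine Finite.of_finite_image (f := Prod.fst) (h.finite.subset ?_) ?_
    · rintro _ ⟨p, hp, rfl⟩
      exact hp.2
    · rintro ⟨p, q⟩ hp ⟨p', q'⟩ hp' heq
      obtain rfl : p = p' := heq
      exact Prod.ext rfl (hp.1.right_unique hp'.1)
  have hr : {p : ℝ × ℝ | IsGap (singularSet s D) p.1 p.2 ∧ p.2 ∈ D}.Finite := by
    refine Finite.of_finite_image (f := Prod.snd) (h.finite.subset ?_) ?_
    · rintro _ ⟨p, hp, rfl⟩
      exact hp.2
    · rintro ⟨p, q⟩ hp ⟨p', q'⟩ hp' heq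
      obtain rfl : q = q' := heq
      exact Prod.ext (hp.1.left_unique hp'.1) rfl
  have h1 := hl.union hr
  set S := {p : ℝ × ℝ | IsGap (singularSet s D) p.1 p.2 ∧ p.1 ∈ D} ∪
    {p : ℝ × ℝ | IsGap (singularSet s D) p.1 p.2 ∧ p.2 ∈ D} with hS
  have h2 : (⋃ q ∈ S, {p : ℝ × ℝ | IsGap (singularSet s D) p.1 p.2 ∧
      s ((q.1 + q.2) / 2) ∈ Ioo p.1 p.2}).Finite := by
    refine h1.biUnion fun q _ => Subsingleton.finite ?_
    rintro p hp p' hp'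
    obtain ⟨h3, h4⟩ := hp.1.eq_of_mem hp'.1 hp.2 hp'.2
    exact Prod.ext h3 h4
  refine (h.finite.union (((h1.union h2).image Prod.fst).union
    ((h1.union h2).image Prod.snd))).subset ?_
  rintro x (hx | ⟨a, b, hab, hx⟩)
  · exact Or.inl hx
  have hmem : (a, b) ∈ S ∪ ⋃ q ∈ S, {p : ℝ × ℝ | IsGap (singularSet s D) p.1 p.2 ∧
      s ((q.1 + q.2) / 2) ∈ Ioo p.1 p.2} := by
    obtain ⟨hg, (h3 | h3) | ⟨c, d, hcd, himg, h3⟩⟩ := hab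
    · exact Or.inl (Or.inl ⟨hg, h3⟩)
    · exact Or.inl (Or.inr ⟨hg, h3⟩)
    · right
      refine mem_iUnion₂.2 ⟨(c, d), ?_, hg, ?_⟩
      · exact h3.imp (fun h3 => ⟨hcd, h3⟩) (fun h3 => ⟨hcd, h3⟩)
      · rw [← h.image_symm himg]
        exact mem_image_of_mem s hcd.midpoint_mem
  right
  rcases hx with rfl | rfl
  · exact Or.inl ⟨_, hmem, rfl⟩
  · exact Or.inr ⟨_, hmem, rfl⟩

/-- The possible positions of the image of a gap with a non-exceptional endpoint: the image has
endpoints `s a` and `s b`, or the gap is folded onto an adjacent one. -/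
theorem image_cases (h : IsPairing s D) (hab : IsGap (singularSet s D) a b)
    (hx : a ∉ exceptionalSet s D ∨ b ∉ exceptionalSet s D) :
    ∃ c d, IsGap (singularSet s D) c d ∧ s '' Ioo a b = Ioo c d ∧
      c ∈ Icc (0 : ℝ) 1 \ D ∧ d ∈ Icc (0 : ℝ) 1 \ D ∧
      (((c = s a ∧ d = s b ∨ d = s a ∧ c = s b) ∧
          Tendsto s (𝓝[>] a) (𝓝 (s a)) ∧ Tendsto s (𝓝[<] b) (𝓝 (s b))) ∨
        (d = a ∧ c = s b ∧ Tendsto s (𝓝[<] b) (𝓝 (s b))) ∨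
        (c = b ∧ d = s a ∧ Tendsto s (𝓝[>] a) (𝓝 (s a)))) := by
  have hbad : ¬ IsBadGap s D a b := by
    intro hbad
    rcases hx with hx | hx
    · exact hx (Or.inr ⟨a, b, hbad, Or.inl rfl⟩)
    · exact hx (Or.inr ⟨a, b, hbad, Or.inr rfl⟩)
  obtain ⟨c, d, hcd, himg⟩ := h.exists_image_eq hab
  have haD : a ∉ D := fun h' => hbad ⟨hab, Or.inl (Or.inl h')⟩
  have hbD : b ∉ D := fun h' => hbad ⟨hab, Or.inl (Or.inr h')⟩
  have hcD : c ∉ D := fun h' => hbad ⟨hab, Or.inr ⟨c, d, hcd, himg, Or.inl h'⟩⟩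
  have hdD : d ∉ D := fun h' => hbad ⟨hab, Or.inr ⟨c, d, hcd, himg, Or.inr h'⟩⟩
  have ha : a ∈ Icc (0 : ℝ) 1 \ D := ⟨(h.gap_mem_Icc hab).1, haD⟩
  have hb : b ∈ Icc (0 : ℝ) 1 \ D := ⟨(h.gap_mem_Icc hab).2, hbD⟩
  have hc : c ∈ Icc (0 : ℝ) 1 \ D := ⟨(h.gap_mem_Icc hcd).1, hcD⟩
  have hd : d ∈ Icc (0 : ℝ) 1 \ D := ⟨(h.gap_mem_Icc hcd).2, hdD⟩
  refine ⟨c, d, hcd, himg, hc, hd, ?_⟩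
  rcases h.tendsto_ends hab himg hcd.lt with ⟨h1, h2⟩ | ⟨h1, h2⟩
  · left
    have e1 : c = s a := by
      refine (h.eq_or_eq _ a c ha hc nhdsWithin_le_nhds h1).resolve_left ?_
      rintro rfl
      obtain rfl := hab.right_unique hcd
      exact h.image_ne hab himg
    have e2 : d = s b := by
      refine (h.eq_or_eq _ b d hb hd nhdsWithin_le_nhds h2).resolve_left ?_
      rintro rfl
      obtain rfl := hab.left_unique hcd
      exact h.image_ne hab himg
    exact ⟨Or.inl ⟨e1, e2⟩, e1 ▸ h1, e2 ▸ h2⟩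
  · rcases h.eq_or_eq _ a d ha hd nhdsWithin_le_nhds h1 with e1 | e1 <;>
      rcases h.eq_or_eq _ b c hb hc nhdsWithin_le_nhds h2 with e2 | e2
    · have := hab.lt
      have := hcd.lt
      linarith
    · exact Or.inr (Or.inl ⟨e1, e2, e2 ▸ h2⟩)
    · exact Or.inr (Or.inr ⟨e2, e1, e1 ▸ h1⟩)
    · exact Or.inl ⟨Or.inr ⟨e1, e2⟩, e1 ▸ h1, e2 ▸ h2⟩

/-- At an isolated non-exceptional singular point, `s` folds. -/
theorem fold_of_isolated (h : IsPairing s D) (hl : IsGap (singularSet s D) c m)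
    (hr : IsGap (singularSet s D) m e) (hm : m ∉ exceptionalSet s D) :
    s '' Ioo c m = Ioo m e ∧ s c = e := by
  obtain ⟨c₁, d₁, h₁, i₁, -, -, hh₁⟩ := h.image_cases hl (Or.inr hm)
  obtain ⟨c₂, d₂, h₂, i₂, -, -, hh₂⟩ := h.image_cases hr (Or.inl hm)
  have hfold : c₁ = m → d₁ = s c → s '' Ioo c m = Ioo m e ∧ s c = e := by
    rintro rfl rfl
    have := h₁.right_unique hr
    exact ⟨this ▸ i₁, this⟩
  have hL : Tendsto s (𝓝[<] m) (𝓝 (s m)) ∨ (c₁ = m ∧ d₁ = s c) := by tauto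
  have hR : Tendsto s (𝓝[>] m) (𝓝 (s m)) ∨ (d₂ = m ∧ c₂ = s e) := by tauto
  rcases hL with hL | ⟨e1, e2⟩
  swap
  · exact hfold e1 e2
  rcases hR with hR | ⟨rfl, rfl⟩
  · exfalso
    have hmA : m ∈ Icc (0 : ℝ) 1 \ D :=
      ⟨(h.gap_mem_Icc hl).2, fun h' => hm (Or.inl h')⟩
    have hcont : ContinuousAt s m :=
      continuousAt_iff_continuous_left'_right'.2 ⟨hL, hR⟩
    refine hl.right_mem (mem_interior_iff_mem_nhds.2 (mem_of_superset
      (Ioo_mem_nhds hl.lt hr.lt) fun y hy => ?_))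
    rcases lt_trichotomy y m with h0 | rfl | h0
    · exact interior_subset (h.gap_subset hl ⟨hy.1, h0⟩)
    · exact ⟨hmA, hcont⟩
    · exact interior_subset (h.gap_subset hr ⟨h0, hy.2⟩)
  · have := hl.left_unique h₂
    exact ⟨h.image_symm (this ▸ i₂), by rw [this, h.invol]⟩

/-- Two folds are never adjacent. -/
theorem mem_exceptionalSet_of_adjacent (h : IsPairing s D) (h₁ : IsGap (singularSet s D) a b)
    (h₂ : IsGap (singularSet s D) b c) (h₃ : IsGap (singularSet s D) c d)
    (hc : c ∉ exceptionalSet s D) : b ∈ exceptionalSet s D := by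
  by_contra hb
  have i₁ := h.image_symm (h.fold_of_isolated h₁ h₂ hb).1
  have i₂ := (h.fold_of_isolated h₂ h₃ hc).1
  rw [i₁] at i₂
  have := i₂ ▸ h₁.midpoint_mem
  linarith [this.1, h₁.midpoint_mem.2, h₂.lt]

theorem tendsto_of_ultrafilter (h : IsPairing s D) {g : Ultrafilter ℝ} {ε : ℝ} (hε : 0 < ε)
    (hx : x ∈ Icc (0 : ℝ) 1 \ D) (hg : (g : Filter ℝ) ≤ 𝓝 x)
    (hK : ∀ᶠ y in (g : Filter ℝ), ∀ d ∈ D, ε ≤ |s y - d|)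
    (hne : ∀ w, Tendsto s g (𝓝 w) → w ≠ x) : Tendsto s g (𝓝 (s x)) := by
  have hI : ∀ᶠ y in (g : Filter ℝ), y ∈ Icc (0 : ℝ) 1 \ D := hg (h.isOpen_diff.mem_nhds hx)
  have hsI : Icc (0 : ℝ) 1 ∈ g.map s := Ultrafilter.mem_map.2 (hI.mono fun y hy => h.mem_Icc y hy.1)
  obtain ⟨w, hw, hgw⟩ := isCompact_Icc.ultrafilter_le_nhds' _ hsI
  have hgw' : Tendsto s g (𝓝 w) := hgw
  have hwD : w ∉ D := by
    intro hwD
    have h1 : Tendsto (fun y => |s y - w|) g (𝓝 |w - w|) :=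
      (hgw'.sub tendsto_const_nhds).abs
    have h2 := ge_of_tendsto h1 (hK.mono fun y hy => hy w hwD)
    simp at h2
    linarith
  rcases h.eq_or_eq g x w hx ⟨hw, hwD⟩ hg hgw' with h1 | h1
  · exact absurd h1 (hne w hgw')
  · exact h1 ▸ hgw'

theorem isolated_of_not_accPt (h : IsPairing s D) (hm : m ∈ Icc (0 : ℝ) 1 \ D)
    (hmE : m ∈ singularSet s D) (hacc : ¬ AccPt m (𝓟 (singularSet s D))) :
    (∃ c, IsGap (singularSet s D) c m) ∧ ∃ e, IsGap (singularSet s D) m e := by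
  rw [accPt_iff_nhds] at hacc
  push Not at hacc
  obtain ⟨U, hU, hUE⟩ := hacc
  obtain ⟨p, q, hpq, hsub⟩ := mem_nhds_iff_exists_Ioo_subset.1
    (inter_mem hU (h.isOpen_diff.mem_nhds hm))
  have h0 := h.subset_singularSet h.zero_mem
  have h1 := h.subset_singularSet h.one_mem
  constructor
  · obtain ⟨x, hpx, hxm⟩ := exists_between hpq.1
    have hx := hsub ⟨hpx, hxm.trans hpq.2⟩
    have hxE : x ∉ singularSet s D := fun h' => hxm.ne (hUE x ⟨hx.1, h'⟩)
    obtain ⟨a, b, hab, hxab⟩ := exists_isGap h.isClosed_singularSet hxE h0 hx.2.1.1 hmE hxm.le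
    have hbm := hab.le_of_mem hxab hmE hxm.le
    have hb := hsub ⟨hpx.trans hxab.2, hbm.trans_lt hpq.2⟩
    exact ⟨a, hUE b ⟨hb.1, hab.right_mem⟩ ▸ hab⟩
  · obtain ⟨x, hmx, hxq⟩ := exists_between hpq.2
    have hx := hsub ⟨hpq.1.trans hmx, hxq⟩
    have hxE : x ∉ singularSet s D := fun h' => hmx.ne' (hUE x ⟨hx.1, h'⟩)
    obtain ⟨a, b, hab, hxab⟩ := exists_isGap h.isClosed_singularSet hxE hmE hmx.le h1 hx.2.1.2
    have hma := hab.ge_of_mem hxab hmE hmx.le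
    have ha := hsub ⟨hpq.1.trans_le hma, hxab.1.trans hxq⟩
    exact ⟨b, hUE a ⟨ha.1, hab.left_mem⟩ ▸ hab⟩

theorem isOpen_nonexceptional (h : IsPairing s D) :
    IsOpen ((Icc (0 : ℝ) 1 \ D) \ exceptionalSet s D) :=
  h.isOpen_diff.sdiff h.finite_exceptionalSet.isClosed

/-- Near some accumulation point of the singular set, `s` moves the accumulation points of the
singular set by a definite amount, and away from `D`. -/
theorem exists_uniform_interval (h : IsPairing s D) {T : Set ℝ}
    (hT : T = ((Icc (0 : ℝ) 1 \ D) \ exceptionalSet s D) ∩ derivedSet (singularSet s D))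
    (hne : T.Nonempty) :
    ∃ ε > 0, ∃ u v, v - u < ε ∧ Ioo u v ⊆ (Icc (0 : ℝ) 1 \ D) \ exceptionalSet s D ∧
      (T ∩ Ioo u v).Nonempty ∧
      ∀ x ∈ T ∩ Ioo u v, ε ≤ |s x - x| ∧ ∀ d ∈ D, ε ≤ |s x - d| := by
  have hlc : IsLocallyClosed T := hT ▸
    h.isOpen_nonexceptional.isLocallyClosed.inter (isClosed_derivedSet _).isLocallyClosed
  have := hlc.locallyCompactSpace
  have := hne.to_subtype
  have hTA : ∀ x ∈ T, x ∈ Icc (0 : ℝ) 1 \ D := fun x hx => (hT.subset hx).1.1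
  let F : ℕ → Set T := fun n => {x | 1 / ((n : ℝ) + 1) ≤ |s x - x| ∧
    ∀ d ∈ D, 1 / ((n : ℝ) + 1) ≤ |s x - d|}
  have hF : ∀ n, IsClosed (F n) := by
    intro n
    have hn : (0 : ℝ) < 1 / ((n : ℝ) + 1) := Nat.one_div_pos_of_nat
    rw [isClosed_iff_ultrafilter]
    intro x g hg hgF
    have hgx : ((g.map (Subtype.val : T → ℝ) : Ultrafilter ℝ) : Filter ℝ) ≤ 𝓝 (x : ℝ) :=
      (continuous_subtype_val.tendsto x).mono_left hg
    have hgF' : ∀ᶠ y in ((g.map (Subtype.val : T → ℝ) : Ultrafilter ℝ) : Filter ℝ),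
        1 / ((n : ℝ) + 1) ≤ |s y - y| ∧ ∀ d ∈ D, 1 / ((n : ℝ) + 1) ≤ |s y - d| := hgF
    set g' := g.map (Subtype.val : T → ℝ)
    have hlim : ∀ w, Tendsto s g' (𝓝 w) → 1 / ((n : ℝ) + 1) ≤ |w - x| := fun w hw =>
      ge_of_tendsto (hw.sub hgx).abs (hgF'.mono fun y hy => hy.1)
    have hs := h.tendsto_of_ultrafilter hn (hTA x x.2) hgx (hgF'.mono fun y hy => hy.2) (by
      rintro w hw rfl
      have := hlim _ hw
      simp at this
      linarith)
    exact ⟨hlim _ hs, fun d hd => ge_of_tendsto (hs.sub tendsto_const_nhds).abs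
      (hgF'.mono fun y hy => hy.2 d hd)⟩
  have hU : ⋃ n, F n = univ := by
    refine eq_univ_of_forall fun x => mem_iUnion.2 ?_
    have h1 : ∀ᶠ n : ℕ in atTop, 1 / ((n : ℝ) + 1) ≤ |s x - x| :=
      (tendsto_one_div_add_atTop_nhds_zero_nat.eventually_lt_const
        (abs_pos.2 (sub_ne_zero.2 (h.ne_self x)))).mono fun _ => le_of_lt
    have h2 : ∀ᶠ n : ℕ in atTop, ∀ d ∈ D, 1 / ((n : ℝ) + 1) ≤ |s x - d| := by
      refine h.finite.eventually_all.2 fun d hd => ?_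
      refine (tendsto_one_div_add_atTop_nhds_zero_nat.eventually_lt_const
        (abs_pos.2 (sub_ne_zero.2 ?_))).mono fun _ => le_of_lt
      rintro rfl
      exact (h.mem_diff (hTA x x.2)).2 hd
    exact (h1.and h2).exists
  obtain ⟨n, z, hz⟩ := nonempty_interior_of_iUnion_of_closed hF hU
  obtain ⟨V, hV, hVF⟩ := mem_nhds_subtype _ _ _ |>.1 (mem_interior_iff_mem_nhds.1 hz)
  have hn : (0 : ℝ) < 1 / ((n : ℝ) + 1) := Nat.one_div_pos_of_nat
  have hzN : (z : ℝ) ∈ (Icc (0 : ℝ) 1 \ D) \ exceptionalSet s D :=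
    (hT.subset z.2).1
  have hnh := inter_mem (inter_mem hV (h.isOpen_nonexceptional.mem_nhds hzN))
    (Ioo_mem_nhds (show (z : ℝ) - 1 / ((n : ℝ) + 1) / 4 < z by linarith)
      (show (z : ℝ) < z + 1 / ((n : ℝ) + 1) / 4 by linarith))
  obtain ⟨u, v, huv, hsub⟩ := mem_nhds_iff_exists_Ioo_subset.1 hnh
  have hlu := huv.1.trans huv.2
  have hcl := closure_mono (hsub.trans inter_subset_right)
  rw [closure_Ioo hlu.ne, closure_Ioo (by linarith)] at hcl
  have hu := hcl ⟨le_rfl, hlu.le⟩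
  have hv := hcl ⟨hlu.le, le_rfl⟩
  refine ⟨_, hn, u, v, ?_, fun x hx => (hsub hx).1.2, ⟨z, z.2, huv⟩, fun x hx => ?_⟩
  · linarith [hu.1, hv.2]
  · exact hVF (show (⟨x, hx.1⟩ : T) ∈ Subtype.val ⁻¹' V from (hsub hx.2).1.1)

theorem not_accPt (h : IsPairing s D) (hx : x ∈ Icc (0 : ℝ) 1 \ D)
    (hxE : x ∉ exceptionalSet s D) : ¬ AccPt x (𝓟 (singularSet s D)) := by
  intro hacc
  obtain ⟨T, hT⟩ : ∃ T, T = ((Icc (0 : ℝ) 1 \ D) \ exceptionalSet s D) ∩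
    derivedSet (singularSet s D) := ⟨_, rfl⟩
  obtain ⟨ε, hε, u, v, huv, hN, ⟨z, hzT, hz⟩, hTε⟩ :=
    h.exists_uniform_interval hT ⟨x, hT ▸ ⟨⟨hx, hxE⟩, hacc⟩⟩
  have hiso : ∀ m ∈ singularSet s D, m ∈ Ioo u v → m ∉ T →
      (∃ c, IsGap (singularSet s D) c m) ∧ ∃ e, IsGap (singularSet s D) m e := by
    intro m hm hmU hmT
    exact h.isolated_of_not_accPt (hN hmU).1 hm fun h' => hmT (hT ▸ ⟨hN hmU, h'⟩)
  have hmid : ∀ m ∈ singularSet s D, ∀ y ∈ singularSet s D, ∀ y' ∈ singularSet s D,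
      y ∈ Ioo u v → y' ∈ Ioo u v → y < m → m < y' → m ∈ T := by
    intro m hm y hy y' hy' hyU hy'U hym hmy'
    by_contra hmT
    have hmU : m ∈ Ioo u v := ⟨hyU.1.trans hym, hmy'.trans hy'U.2⟩
    obtain ⟨⟨c, hcm⟩, e, hme⟩ := hiso m hm hmU hmT
    have hyc : y ≤ c := not_lt.1 fun h' => hcm.notMem y ⟨h', hym⟩ hy
    have hey : e ≤ y' := not_lt.1 fun h' => hme.notMem y' ⟨hmy', h'⟩ hy'
    have hcU : c ∈ Ioo u v := ⟨hyU.1.trans_le hyc, hcm.lt.trans hmU.2⟩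
    have heU : e ∈ Ioo u v := ⟨hmU.1.trans hme.lt, hey.trans_lt hy'U.2⟩
    have hcT : c ∈ T := by
      by_contra hcT
      obtain ⟨⟨b, hbc⟩, -⟩ := hiso c hcm.left_mem hcU hcT
      exact (hN hcU).2 (h.mem_exceptionalSet_of_adjacent hbc hcm hme (hN hmU).2)
    have h1 := (hTε c ⟨hcT, hcU⟩).1
    rw [(h.fold_of_isolated hcm hme (hN hmU).2).2] at h1
    exact absurd (dist_lt_of_mem_Ioo huv heU hcU) (not_lt.2 h1)
  have hinf : (Ioo u v ∩ singularSet s D).Infinite :=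
    Set.Infinite.of_accPt (AccPt.nhds_inter (hT.subset hzT).2 (Ioo_mem_nhds hz.1 hz.2))
  obtain ⟨t, ht, htc⟩ := hinf.exists_subset_card_eq 5
  set p := t.orderEmbOfFin htc
  have hpm : ∀ i, p i ∈ Ioo u v ∩ singularSet s D := fun i => ht (t.orderEmbOfFin_mem htc i)
  have h01 : p 0 < p 1 := p.strictMono (by decide)
  have h12 : p 1 < p 2 := p.strictMono (by decide)
  have h23 : p 2 < p 3 := p.strictMono (by decide)
  have h34 : p 3 < p 4 := p.strictMono (by decide)
  have hsubU : ∀ y, p 1 ≤ y → y ≤ p 3 → y ∈ Ioo u v := fun y h1 h3 =>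
    ⟨(hpm 1).1.1.trans_le h1, h3.trans_lt (hpm 3).1.2⟩
  have hmT : ∀ y ∈ singularSet s D, p 1 ≤ y → y ≤ p 3 → y ∈ T := fun y hy h1 h3 =>
    hmid y hy _ (hpm 0).2 _ (hpm 4).2 (hpm 0).1 (hpm 4).1 (h01.trans_le h1) (h3.trans_lt h34)
  have hsε : ∀ y ∈ singularSet s D, p 1 ≤ y → y ≤ p 3 →
      ε ≤ |s y - y| ∧ ∀ d ∈ D, ε ≤ |s y - d| := fun y hy h1 h3 =>
    hTε y ⟨hmT y hy h1 h3, hsubU y h1 h3⟩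
  have hsout : ∀ y ∈ singularSet s D, p 1 ≤ y → y ≤ p 3 → ¬ (p 1 ≤ s y ∧ s y ≤ p 3) :=
    fun y hy h1 h3 h' => absurd (dist_lt_of_mem_Ioo huv (hsubU _ h'.1 h'.2) (hsubU y h1 h3))
      (not_lt.2 (hsε y hy h1 h3).1)
  have hniso : ∀ y, p 1 ≤ y → y ≤ p 3 → ∀ c e, IsGap (singularSet s D) c y →
      ¬ IsGap (singularSet s D) y e := by
    intro y h1 h3 c e hcy hye
    have hacc := (hT.subset (hmT y hcy.right_mem h1 h3)).2
    obtain ⟨q, hq, hqy⟩ := accPt_iff_nhds.1 hacc _ (Ioo_mem_nhds hcy.lt hye.lt)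
    rcases lt_or_gt_of_ne hqy with h0 | h0
    · exact hcy.notMem q ⟨hq.1.1, h0⟩ hq.2
    · exact hye.notMem q ⟨h0, hq.1.2⟩ hq.2
  have hmain : ∀ y ∈ Ioo (p 1) (p 3), s y ∉ Ioo (p 1) (p 3) ∧ ∀ d ∈ D, ε ≤ |s y - d| := by
    intro y hy
    by_cases hyE : y ∈ singularSet s D
    · exact ⟨fun h' => hsout y hyE hy.1.le hy.2.le ⟨h'.1.le, h'.2.le⟩,
        (hsε y hyE hy.1.le hy.2.le).2⟩
    obtain ⟨a, b, hab, hyab⟩ :=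
      exists_isGap h.isClosed_singularSet hyE (hpm 1).2 hy.1.le (hpm 3).2 hy.2.le
    have ha1 := hab.ge_of_mem hyab (hpm 1).2 hy.1.le
    have hb3 := hab.le_of_mem hyab (hpm 3).2 hy.2.le
    have ha3 : a ≤ p 3 := hab.lt.le.trans hb3
    have hb1 : p 1 ≤ b := ha1.trans hab.lt.le
    obtain ⟨c, d, hcd, himg, -, -, hh⟩ := h.image_cases hab (Or.inl (hN (hsubU a ha1 ha3)).2)
    have hsy : s y ∈ Ioo c d := himg ▸ mem_image_of_mem s hyab
    have hends : (c = s a ∧ d = s b) ∨ (d = s a ∧ c = s b) := by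
      rcases hh with hh | ⟨rfl, -⟩ | ⟨rfl, -⟩
      · exact hh.1
      · exact absurd hab (hniso _ ha1 ha3 _ _ hcd)
      · exact absurd hcd (hniso _ hb1 hb3 _ _ hab)
    obtain ⟨hcout, hcε⟩ : ¬ (p 1 ≤ c ∧ c ≤ p 3) ∧ ∀ d ∈ D, ε ≤ |c - d| := by
      rcases hends with ⟨h1, -⟩ | ⟨-, h1⟩ <;> rw [h1]
      · exact ⟨hsout a hab.left_mem ha1 ha3, (hsε a hab.left_mem ha1 ha3).2⟩
      · exact ⟨hsout b hab.right_mem hb1 hb3, (hsε b hab.right_mem hb1 hb3).2⟩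
    have hdε : ∀ d' ∈ D, ε ≤ |d - d'| := by
      rcases hends with ⟨-, h1⟩ | ⟨h1, -⟩ <;> rw [h1]
      · exact (hsε b hab.right_mem hb1 hb3).2
      · exact (hsε a hab.left_mem ha1 ha3).2
    refine ⟨fun h' => hcout ⟨hcd.ge_of_mem hsy (hpm 1).2 h'.1.le, (hsy.1.trans h'.2).le⟩, ?_⟩
    intro q hq
    have hqE := h.subset_singularSet hq
    rcases le_total (s y) q with h0 | h0
    · have h1 := hcd.le_of_mem hsy hqE h0
      have h2 := hdε q hq
      rw [abs_of_nonpos (by linarith)] at h2 ⊢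
      linarith [hsy.2]
    · have h1 := hcd.ge_of_mem hsy hqE h0
      have h2 := hcε q hq
      rw [abs_of_nonneg (by linarith)] at h2 ⊢
      linarith [hsy.1]
  have hcont : ∀ y ∈ Ioo (p 1) (p 3), ContinuousAt s y := by
    intro y hy
    refine (tendsto_iff_ultrafilter _ _ _).2 fun g hg => ?_
    have hgI : ∀ᶠ q in (g : Filter ℝ), q ∈ Ioo (p 1) (p 3) := hg (Ioo_mem_nhds hy.1 hy.2)
    refine h.tendsto_of_ultrafilter hε (hN (hsubU y hy.1.le hy.2.le)).1 hg
      (hgI.mono fun q hq => (hmain q hq).2) ?_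
    rintro w hw rfl
    obtain ⟨q, hq, hq'⟩ := (hgI.and (hw (Ioo_mem_nhds hy.1 hy.2))).exists
    exact (hmain q hq).1 hq'
  exact (hpm 2).2 (mem_interior_iff_mem_nhds.2 (mem_of_superset (Ioo_mem_nhds h12 h23)
    fun y hy => ⟨(hN (hsubU y hy.1.le hy.2.le)).1, hcont y hy⟩))

theorem finite_singularSet_inter (h : IsPairing s D) : (singularSet s D ∩ Icc 0 1).Finite := by
  have h1 : (⋃ c ∈ exceptionalSet s D, {m | IsGap (singularSet s D) c m}).Finite :=
    h.finite_exceptionalSet.biUnion fun c _ =>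
      Subsingleton.finite fun m hm m' hm' => hm.right_unique hm'
  refine (h.finite_exceptionalSet.union h1).subset ?_
  rintro m ⟨hm, hmI⟩
  by_cases hmE : m ∈ exceptionalSet s D
  · exact Or.inl hmE
  right
  have hiso : ∀ m ∈ singularSet s D, m ∈ Icc (0 : ℝ) 1 → m ∉ exceptionalSet s D →
      (∃ c, IsGap (singularSet s D) c m) ∧ ∃ e, IsGap (singularSet s D) m e := by
    intro m hm hmI hmE
    have hmA : m ∈ Icc (0 : ℝ) 1 \ D := ⟨hmI, fun h' => hmE (Or.inl h')⟩
    exact h.isolated_of_not_accPt hmA hm (h.not_accPt hmA hmE)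
  obtain ⟨⟨c, hcm⟩, e, hme⟩ := hiso m hm hmI hmE
  refine mem_iUnion₂.2 ⟨c, ?_, hcm⟩
  by_contra hcE
  obtain ⟨⟨b, hbc⟩, -⟩ := hiso c hcm.left_mem (h.gap_mem_Icc hcm).1 hcE
  exact hcE (h.mem_exceptionalSet_of_adjacent hbc hcm hme hmE)

theorem not_isPairing (s : ℝ → ℝ) (D : Set ℝ) : ¬ IsPairing s D := by
  intro h
  have hfin := h.finite_singularSet_inter
  set t := hfin.toFinset with ht
  have hmem : ∀ x, x ∈ t ↔ x ∈ singularSet s D ∧ x ∈ Icc (0 : ℝ) 1 := fun x => by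
    simp [ht]
  have h1t : (1 : ℝ) ∈ t := (hmem 1).2 ⟨h.subset_singularSet h.one_mem, h.subset h.one_mem⟩
  have heven : Even t.card := even_card_of_involution t (fun x _ => s x) (fun x _ => h.ne_self x)
    (fun x hx => (hmem _).2 ⟨h.mem_singularSet_of_mem ((hmem x).1 hx).1,
      h.mem_Icc x ((hmem x).1 hx).2⟩) (fun x _ => h.invol x)
  have hgap : ∀ a ∈ t.erase 1, ∃ b, IsGap (singularSet s D) a b := by
    intro a ha
    obtain ⟨ha1, ha⟩ := Finset.mem_erase.1 ha
    have ha' := (hmem a).1 ha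
    have hne : (t.filter (a < ·)).Nonempty :=
      ⟨1, Finset.mem_filter.2 ⟨h1t, lt_of_le_of_ne ha'.2.2 ha1⟩⟩
    obtain ⟨hb, hab⟩ := Finset.mem_filter.1 (Finset.min'_mem _ hne)
    refine ⟨_, hab, ha'.1, ((hmem _).1 hb).1, fun x hx hxE => ?_⟩
    have hxt : x ∈ t := (hmem x).2 ⟨hxE, ha'.2.1.trans hx.1.le,
      hx.2.le.trans ((hmem _).1 hb).2.2⟩
    exact absurd (Finset.min'_le _ x (Finset.mem_filter.2 ⟨hxt, hx.1⟩)) (not_le.2 hx.2)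
  have hpart : ∀ a ∈ t.erase 1, ∃ c, ∃ b d, IsGap (singularSet s D) a b ∧
      IsGap (singularSet s D) c d ∧ s '' Ioo a b = Ioo c d := by
    intro a ha
    obtain ⟨b, hab⟩ := hgap a ha
    obtain ⟨c, d, hcd, himg⟩ := h.exists_image_eq hab
    exact ⟨c, b, d, hab, hcd, himg⟩
  choose g hg using hpart
  have heven' : Even (t.erase 1).card := by
    refine even_card_of_involution _ g ?_ ?_ ?_
    · intro a ha heq
      obtain ⟨b, d, hab, hcd, himg⟩ := hg a ha
      rw [heq] at hcd himg
      rw [← hab.right_unique hcd] at himg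
      exact h.image_ne hab himg
    · intro a ha
      obtain ⟨b, d, hab, hcd, himg⟩ := hg a ha
      have := h.gap_mem_Icc hcd
      exact Finset.mem_erase.2 ⟨(hcd.lt.trans_le this.2.2).ne,
        (hmem _).2 ⟨hcd.left_mem, this.1⟩⟩
    · intro a ha
      obtain ⟨b, d, hab, hcd, himg⟩ := hg a ha
      obtain ⟨d', b', hcd', hab', himg'⟩ := hg (g a ha) (by
        have := h.gap_mem_Icc hcd
        exact Finset.mem_erase.2 ⟨(hcd.lt.trans_le this.2.2).ne,
          (hmem _).2 ⟨hcd.left_mem, this.1⟩⟩)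
      rw [← hcd.right_unique hcd', h.image_symm himg] at himg'
      have hm := hab.midpoint_mem
      exact (hab.eq_of_mem hab' hm (himg' ▸ hm)).1.symm
  rw [Finset.card_erase_of_mem h1t] at heven'
  have := Finset.card_pos.2 ⟨1, h1t⟩
  obtain ⟨k, hk⟩ := heven
  obtain ⟨l, hl⟩ := heven'
  omega

end IsPairing

/-- There is no exactly 2-to-1 function from `[0,1]` onto a compact metric
space having only finitely many discontinuities. -/
theorem no_finitely_discontinuous_two_to_one_on_interval :
    ¬ ∃ (Y : Type) (_ : MetricSpace Y), CompactSpace Y ∧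
      ∃ f : unitInterval → Y, Function.Surjective f ∧
        (∀ y : Y, Nat.card (f ⁻¹' {y}) = 2) ∧
        {x : unitInterval | ¬ ContinuousAt f x}.Finite := by
  rintro ⟨Y, _, -, f, -, hcard, hfin⟩
  have hpartner : ∀ x : unitInterval, ∃ y, y ≠ x ∧ f y = f x ∧ ∀ w, f w = f x → w = x ∨ w = y := by
    intro x
    obtain ⟨⟨y, hy⟩, hyx, huniq⟩ :=
      (Nat.card_eq_two_iff' (⟨x, rfl⟩ : f ⁻¹' {f x})).1 (hcard (f x))
    refine ⟨y, fun h' => hyx (Subtype.ext h'), hy, fun w hw => ?_⟩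
    by_cases hwx : w = x
    · exact Or.inl hwx
    · exact Or.inr (congrArg Subtype.val
        (huniq ⟨w, hw⟩ fun h' => hwx (congrArg Subtype.val h')))
  choose σ hσne hσf hσ using hpartner
  have hσσ : ∀ x, σ (σ x) = x := fun x =>
    (hσ x (σ (σ x)) ((hσf _).trans (hσf x))).resolve_right (hσne _)
  set D₁ : Set unitInterval := {x | ¬ ContinuousAt f x} ∪ {0, 1} with hD₁
  have hD₁fin : D₁.Finite := hfin.union (by simp)
  set D₀ : Set unitInterval := D₁ ∪ σ '' D₁ with hD₀
  have hD₀fin : D₀.Finite := hD₁fin.union (hD₁fin.image σ)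
  have hD₀σ : ∀ x ∈ D₀, σ x ∈ D₀ := by
    rintro x (hx | ⟨y, hy, rfl⟩)
    · exact Or.inr ⟨x, hx, rfl⟩
    · exact Or.inl ((hσσ y).symm ▸ hy)
  have hcont : ∀ x ∉ D₀, ContinuousAt f x := fun x hx => by
    by_contra h'
    exact hx (Or.inl (Or.inl h'))
  set D : Set ℝ := Subtype.val '' D₀ with hD
  have hDmem : ∀ x : unitInterval, (x : ℝ) ∈ D ↔ x ∈ D₀ := fun x =>
    Subtype.val_injective.mem_set_image
  classical
  let s : ℝ → ℝ := fun x => if hx : x ∈ Icc (0 : ℝ) 1 then σ ⟨x, hx⟩ else 1 - x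
  have hs : ∀ x : unitInterval, s x = σ x := fun x => dif_pos x.2
  have hs' : ∀ x : ℝ, x ∉ Icc (0 : ℝ) 1 → s x = 1 - x := fun x hx => dif_neg hx
  have hout : ∀ x : ℝ, x ∉ Icc (0 : ℝ) 1 → 1 - x ∉ Icc (0 : ℝ) 1 := fun x hx h' =>
    hx ⟨by linarith [h'.2], by linarith [h'.1]⟩
  refine IsPairing.not_isPairing s D ⟨?_, ?_, ?_, hD₀fin.image _, ?_, ?_, ?_, ?_, ?_⟩
  · intro x
    by_cases hx : x ∈ Icc (0 : ℝ) 1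
    · lift x to unitInterval using hx
      rw [hs, hs, hσσ]
    · rw [hs' x hx, hs' _ (hout x hx)]
      ring
  · intro x heq
    by_cases hx : x ∈ Icc (0 : ℝ) 1
    · lift x to unitInterval using hx
      rw [hs] at heq
      exact hσne x (Subtype.ext heq)
    · rw [hs' x hx] at heq
      exact hx ⟨by linarith, by linarith⟩
  · intro x hx
    lift x to unitInterval using hx
    rw [hs]
    exact (σ x).2
  · rintro _ ⟨x, -, rfl⟩
    exact x.2
  · exact ⟨0, Or.inl (Or.inr (by simp)), by simp⟩
  · exact ⟨1, Or.inl (Or.inr (by simp)), by simp⟩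
  · rintro _ ⟨x, hx, rfl⟩
    rw [hs]
    exact (hDmem _).2 (hD₀σ x hx)
  · rintro F _ x w ⟨hx, hxD⟩ ⟨hw, hwD⟩ hF htend
    lift x to unitInterval using hx
    lift w to unitInterval using hw
    rw [hDmem] at hxD hwD
    have hx0 : (0 : ℝ) < x := lt_of_le_of_ne x.2.1 fun h' =>
      hxD (Or.inl (Or.inr (Or.inl (Subtype.ext h'.symm))))
    have hx1 : (x : ℝ) < 1 := lt_of_le_of_ne x.2.2 fun h' =>
      hxD (Or.inl (Or.inr (Or.inr (Subtype.ext h'))))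
    have hI : ∀ᶠ y in F, y ∈ Icc (0 : ℝ) 1 := hF (Icc_mem_nhds hx0 hx1)
    have hne : (comap (Subtype.val : unitInterval → ℝ) F).NeBot := by
      refine comap_neBot fun t ht => ?_
      obtain ⟨y, hy, hyI⟩ := Filter.nonempty_of_mem (inter_mem ht hI)
      exact ⟨⟨y, hyI⟩, hy⟩
    have hFx : Tendsto id (comap (Subtype.val : unitInterval → ℝ) F) (𝓝 x) :=
      tendsto_subtype_rng.2 (tendsto_comap.mono_right hF)
    have hFw : Tendsto σ (comap (Subtype.val : unitInterval → ℝ) F) (𝓝 w) := by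
      refine tendsto_subtype_rng.2 ((htend.comp tendsto_comap).congr fun y => ?_)
      exact hs y
    have h1 : Tendsto f (comap (Subtype.val : unitInterval → ℝ) F) (𝓝 (f x)) :=
      (hcont x hxD).tendsto.comp hFx
    have h2 : Tendsto f (comap (Subtype.val : unitInterval → ℝ) F) (𝓝 (f w)) :=
      ((hcont w hwD).tendsto.comp hFw).congr fun y => hσf y
    rw [hs]
    exact (hσ x w (tendsto_nhds_unique h2 h1)).imp (congrArg _) (congrArg _)
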